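/- arXiv:math/0005113 — 4 statements merged into one kernel-verified Lean document; each statement's English description precedes it below -/
import Mathlib

section
/- For every sequence ω in Ω̂, the spinal group G_ω is infinite. -/
noncomputable section

open Equiv

namespace Spinal

/-- The letter `q` of the alphabet `{1,…,q}` (here `q = m + 2`). -/
def qtop (m : ℕ) : Fin (m + 2) := Fin.last (m + 1)

/-- The letter `1` of the alphabet. -/
def qone (m : ℕ) : Fin (m + 2) := 0


theorem qone_ne_qtop (m : ℕ) : qone m ≠ qtop m := by
  simp [qone, qtop, Fin.ext_iff]

/-- The action of an alphabet permutation on the first letter of a word. -/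
def rootFun (m : ℕ) (a : Equiv.Perm (Fin (m + 2))) :
    List (Fin (m + 2)) → List (Fin (m + 2))
  | [] => []
  | y :: w => a y :: w

theorem rootFun_leftInv (m : ℕ) (a : Equiv.Perm (Fin (m + 2))) (w : List (Fin (m + 2))) :
    rootFun m a.symm (rootFun m a w) = w := by
  cases w <;> simp [rootFun]

/-- The tree automorphism induced by a root permutation. -/
def rootAut (m : ℕ) (a : Equiv.Perm (Fin (m + 2))) : Equiv.Perm (List (Fin (m + 2))) where
  toFun := rootFun m a
  invFun := rootFun m a.symm
  left_inv w := rootFun_leftInv m a w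
  right_inv w := by simpa using rootFun_leftInv m a.symm w

variable {GB : Type*} [Group GB]

/-- The spinal action of `b : G_B` determined by the sequence `ω` of homomorphisms:
at the vertex `q^n 1` the next letter is moved by `ω n b` (0-indexed, so `ω 0` is the
paper's `ω₁`). -/
def spinalFun (m : ℕ) (ω : ℕ → GB →* Equiv.Perm (Fin (m + 2))) (b : GB) :
    ℕ → List (Fin (m + 2)) → List (Fin (m + 2))
  | _, [] => []
  | n, y :: w =>
    if y = qtop m then y :: spinalFun m ω b (n + 1) w
    else if y = qone m then
      y :: (match w with
            | [] => []
            | z :: w' => ω n b z :: w')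
    else y :: w

theorem spinalFun_leftInv (m : ℕ) (ω : ℕ → GB →* Equiv.Perm (Fin (m + 2)))
    (b : GB) (n : ℕ) (w : List (Fin (m + 2))) :
    spinalFun m ω b⁻¹ n (spinalFun m ω b n w) = w := by
  induction w generalizing n with
  | nil => simp [spinalFun]
  | cons y w ih =>
    by_cases h1 : y = qtop m
    · simp [spinalFun, h1, ih]
    · by_cases h2 : y = qone m
      · match w with
        | [] => simp [spinalFun, h1, h2]
        | z :: w' => simp [spinalFun, h1, h2, map_inv, qone_ne_qtop]
      · simp [spinalFun, h1, h2]

/-- The tree automorphism induced by `b : G_B` via the sequence `ω`. -/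
def spinalAut (m : ℕ) (ω : ℕ → GB →* Equiv.Perm (Fin (m + 2))) (b : GB) :
    Equiv.Perm (List (Fin (m + 2))) where
  toFun := spinalFun m ω b 0
  invFun := spinalFun m ω b⁻¹ 0
  left_inv w := spinalFun_leftInv m ω b 0 w
  right_inv w := by simpa using spinalFun_leftInv m ω b⁻¹ 0 w

/-- The canonical generating set `S_ω = A ∪ B_ω` (non-identity induced automorphisms). -/
def genSet (m : ℕ) (GA : Subgroup (Equiv.Perm (Fin (m + 2))))
    (ω : ℕ → GB →* Equiv.Perm (Fin (m + 2))) : Set (Equiv.Perm (List (Fin (m + 2)))) :=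
  ((rootAut m '' (GA : Set (Equiv.Perm (Fin (m + 2))))) ∪
    Set.range fun b : GB => spinalAut m ω b) \ {1}

/-- The spinal group `G_ω`, as a subgroup of the permutation group of the vertex set
of the `(m+2)`-regular rooted tree. -/
def spinalGroup (m : ℕ) (GA : Subgroup (Equiv.Perm (Fin (m + 2))))
    (ω : ℕ → GB →* Equiv.Perm (Fin (m + 2))) : Subgroup (Equiv.Perm (List (Fin (m + 2)))) :=
  Subgroup.closure (genSet m GA ω)

/-- The defining conditions on the data `(G_A, G_B, ω)` of a spinal group:
`G_A` is a transitive (hence faithful) group of permutations of the alphabet,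
every `ω n` is an epimorphism onto `G_A`, and `ω ∈ Ω̂`: from every index on, the kernels
of the remaining homomorphisms cover `G_B` and intersect trivially. -/
structure SpinalData (m : ℕ) (GA : Subgroup (Equiv.Perm (Fin (m + 2))))
    (ω : ℕ → GB →* Equiv.Perm (Fin (m + 2))) : Prop where
  transitive : ∀ i j : Fin (m + 2), ∃ a ∈ GA, a i = j
  range_eq : ∀ n, (ω n).range = GA
  kernels_cover : ∀ i : ℕ, ∀ b : GB, ∃ j, i ≤ j ∧ ω j b = 1
  kernels_sep : ∀ i : ℕ, ∀ b : GB, (∀ j, i ≤ j → ω j b = 1) → b = 1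

/-- Word length of a group element with respect to a set of generators. -/
def wordLength {G : Type*} [Group G] (S : Set G) (g : G) : ℕ :=
  sInf {n | ∃ l : List G, l.length = n ∧ (∀ x ∈ l, x ∈ S) ∧ l.prod = g}

/-- The word growth function `γ_ω` of the spinal group with respect to `S_ω`. -/
def growth (m : ℕ) (GA : Subgroup (Equiv.Perm (Fin (m + 2))))
    (ω : ℕ → GB →* Equiv.Perm (Fin (m + 2))) (n : ℕ) : ℕ :=
  Nat.card {g : Equiv.Perm (List (Fin (m + 2))) //
    g ∈ spinalGroup m GA ω ∧ wordLength (genSet m GA ω) g ≤ n}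

/-- The period growth function `π_ω`: the largest order of an element of word length
at most `n`. -/
def periodGrowth (m : ℕ) (GA : Subgroup (Equiv.Perm (Fin (m + 2))))
    (ω : ℕ → GB →* Equiv.Perm (Fin (m + 2))) (n : ℕ) : ℕ :=
  sSup (orderOf '' {g : Equiv.Perm (List (Fin (m + 2))) |
    g ∈ spinalGroup m GA ω ∧ wordLength (genSet m GA ω) g ≤ n})

/-- Abstract letters for words over `S_ω`: an `A`-letter is (induced by) a permutation
of the alphabet, a `B`-letter is (induced by) an element of `G_B`. -/
abbrev Letter (m : ℕ) (GB : Type*) := Equiv.Perm (Fin (m + 2)) ⊕ GB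

/-- Evaluation of an abstract letter as a tree automorphism. -/
def evalLetter (m : ℕ) (ω : ℕ → GB →* Equiv.Perm (Fin (m + 2))) :
    Letter m GB → Equiv.Perm (List (Fin (m + 2))) :=
  Sum.elim (rootAut m) (spinalAut m ω)

/-- The list of `A`-letters of a word, in order. -/
def aLetters {m : ℕ} {GB : Type*} : List (Letter m GB) → List (Equiv.Perm (Fin (m + 2))) :=
  List.filterMap fun x => match x with
    | Sum.inl a => some a
    | Sum.inr _ => none

/-- The list of `B`-letters of a word, in order. -/
def bLetters {m : ℕ} {GB : Type*} : List (Letter m GB) → List GB :=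
  List.filterMap fun x => match x with
    | Sum.inl _ => none
    | Sum.inr b => some b

/-- A word is reduced if its letters alternate between `A`-letters and `B`-letters and
no letter is the identity. -/
def IsReduced {m : ℕ} (F : List (Letter m GB)) : Prop :=
  List.Chain' (fun x y => x.isLeft ≠ y.isLeft) F ∧
    Sum.inl (1 : Equiv.Perm (Fin (m + 2))) ∉ F ∧ Sum.inr (1 : GB) ∉ F

open scoped Classical in
/-- One step of the (complete, confluent) simple reduction process: prepend a letter to an
already reduced word and reduce. -/
def reduceStep {m : ℕ} : Letter m GB → List (Letter m GB) → List (Letter m GB)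
  | Sum.inl a, [] => if a = 1 then [] else [Sum.inl a]
  | Sum.inr b, [] => if b = 1 then [] else [Sum.inr b]
  | Sum.inl a, Sum.inl a' :: t => if a * a' = 1 then t else Sum.inl (a * a') :: t
  | Sum.inr b, Sum.inr b' :: t => if b * b' = 1 then t else Sum.inr (b * b') :: t
  | Sum.inl a, y :: t => if a = 1 then y :: t else Sum.inl a :: y :: t
  | Sum.inr b, y :: t => if b = 1 then y :: t else Sum.inr b :: y :: t

/-- The reduced form of a word, obtained by simple reductions. -/
def reduceWord {m : ℕ} (F : List (Letter m GB)) : List (Letter m GB) :=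
  F.foldr reduceStep []

open scoped Classical in
/-- The (unreduced) projection of a word, representing an element of the first-level
stabilizer, to the coordinate `i` of the first level: scanning the word from the left
while accumulating the product `g` of the `A`-letters, a `B`-letter `b` contributes the
letter `b` at the coordinate `g(q)` and the letter `ω₁(b)` at the coordinate `g(1)`. -/
def projWord (m : ℕ) (ω0 : GB →* Equiv.Perm (Fin (m + 2))) (i : Fin (m + 2)) :
    List (Letter m GB) → Equiv.Perm (Fin (m + 2)) → List (Letter m GB)
  | [], _ => []
  | Sum.inl a :: F, g => projWord m ω0 i F (g * a)
  | Sum.inr b :: F, g =>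
      ((if g (qtop m) = i then [Sum.inr b] else []) ++
        (if g (qone m) = i then [Sum.inl (ω0 b)] else [])) ++ projWord m ω0 i F g

/-- The list of the `q^r` (reduced) words at level `r` of the depth-`r` decomposition
of a word. -/
def levelWords (m : ℕ) :
    (ℕ → GB →* Equiv.Perm (Fin (m + 2))) → ℕ → List (Letter m GB) →
      List (List (Letter m GB))
  | _, 0, F => [F]
  | ω, r + 1, F =>
      (List.finRange (m + 2)).flatMap fun i =>
        levelWords m (fun n => ω (n + 1)) r (reduceWord (projWord m (ω 0) i F 1))

/-- `|L_r(F)|`: the total length of level `r` of the depth-`r` decomposition of `F`. -/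
def levelLength (m : ℕ) (ω : ℕ → GB →* Equiv.Perm (Fin (m + 2))) (r : ℕ)
    (F : List (Letter m GB)) : ℕ :=
  ((levelWords m ω r F).map List.length).sum

/-- The triangular weight of a letter: `A`-letters have weight `τ₀ = 1 - η^r`; a
`B`-letter `b` has weight `τ_i = η^r + η^(r-i) - 1` where `i` is the smallest (1-based)
index with `ω_i(b) = 1`. -/
def letterWeight (m : ℕ) (ω : ℕ → GB →* Equiv.Perm (Fin (m + 2))) (η : ℝ) (r : ℕ) :
    Letter m GB → ℝ
  | Sum.inl _ => 1 - η ^ r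
  | Sum.inr b => η ^ r + η ^ (r - (sInf {j | ω j b = 1} + 1)) - 1

/-- The total triangular weight of a word. -/
def wordWeight (m : ℕ) (ω : ℕ → GB →* Equiv.Perm (Fin (m + 2))) (η : ℝ) (r : ℕ)
    (F : List (Letter m GB)) : ℝ :=
  (F.map (letterWeight m ω η r)).sum

/-- The weight `∂^τ(g)` of a group element: the least total weight of a word over `S_ω`
representing it. -/
def elemWeight (m : ℕ) (GA : Subgroup (Equiv.Perm (Fin (m + 2))))
    (ω : ℕ → GB →* Equiv.Perm (Fin (m + 2))) (η : ℝ) (r : ℕ)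
    (g : Equiv.Perm (List (Fin (m + 2)))) : ℝ :=
  sInf {x : ℝ | ∃ F : List (Letter m GB),
    (∀ a : Equiv.Perm (Fin (m + 2)), Sum.inl a ∈ F → a ∈ GA) ∧
    (F.map (evalLetter m ω)).prod = g ∧ wordWeight m ω η r F = x}

theorem rootAut_mem_spinalGroup (m : ℕ) {GA : Subgroup (Equiv.Perm (Fin (m + 2)))}
    (ω : ℕ → GB →* Equiv.Perm (Fin (m + 2))) {a : Equiv.Perm (Fin (m + 2))} (ha : a ∈ GA) :
    rootAut m a ∈ spinalGroup m GA ω := by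
  by_cases h : rootAut m a = 1
  · exact h ▸ one_mem _
  · exact Subgroup.subset_closure ⟨Or.inl ⟨a, ha, rfl⟩, h⟩

theorem spinalAut_mem_spinalGroup (m : ℕ) (GA : Subgroup (Equiv.Perm (Fin (m + 2))))
    (ω : ℕ → GB →* Equiv.Perm (Fin (m + 2))) (b : GB) :
    spinalAut m ω b ∈ spinalGroup m GA ω := by
  by_cases h : spinalAut m ω b = 1
  · exact h ▸ one_mem _
  · exact Subgroup.subset_closure ⟨Or.inr ⟨b, rfl⟩, h⟩

theorem rootAut_cons (m : ℕ) (a : Equiv.Perm (Fin (m + 2))) (y : Fin (m + 2))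
    (w : List (Fin (m + 2))) : rootAut m a (y :: w) = a y :: w := rfl

theorem spinalFun_succ (m : ℕ) (ω : ℕ → GB →* Equiv.Perm (Fin (m + 2))) (b : GB) (n : ℕ)
    (w : List (Fin (m + 2))) :
    spinalFun m ω b (n + 1) w = spinalFun m (fun k => ω (k + 1)) b n w := by
  induction w generalizing n with
  | nil => simp [spinalFun]
  | cons y w ih => simp only [spinalFun, ih]

theorem spinalAut_qtop_cons (m : ℕ) (ω : ℕ → GB →* Equiv.Perm (Fin (m + 2))) (b : GB)
    (w : List (Fin (m + 2))) :
    spinalAut m ω b (qtop m :: w) = qtop m :: spinalAut m (fun k => ω (k + 1)) b w := by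
  change spinalFun m ω b 0 (qtop m :: w) = qtop m :: spinalFun m (fun k => ω (k + 1)) b 0 w
  rw [← spinalFun_succ]
  simp [spinalFun]

theorem spinalAut_qone_cons (m : ℕ) (ω : ℕ → GB →* Equiv.Perm (Fin (m + 2))) (b : GB)
    (w : List (Fin (m + 2))) :
    spinalAut m ω b (qone m :: w) = qone m :: rootAut m (ω 0 b) w := by
  change spinalFun m ω b 0 (qone m :: w) = qone m :: rootFun m (ω 0 b) w
  cases w <;> simp [spinalFun, rootFun, qone_ne_qtop]

/-- The stabilizer of the vertex `q` in `G_ω` acts on the subtree below `q` through all of the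
spinal group of the shifted sequence. -/
theorem exists_lift_qtop (m : ℕ) {GA : Subgroup (Equiv.Perm (Fin (m + 2)))}
    (ω : ℕ → GB →* Equiv.Perm (Fin (m + 2)))
    (htrans : ∀ i j : Fin (m + 2), ∃ a ∈ GA, a i = j) (hrange : GA ≤ (ω 0).range)
    {h : Equiv.Perm (List (Fin (m + 2)))} (hh : h ∈ spinalGroup m GA fun k => ω (k + 1)) :
    ∃ g ∈ spinalGroup m GA ω, ∀ w, g (qtop m :: w) = qtop m :: h w := by
  unfold spinalGroup at hh
  induction hh using Subgroup.closure_induction with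
  | mem x hx =>
    obtain ⟨⟨a, ha, rfl⟩ | ⟨b, rfl⟩, -⟩ := hx
    · obtain ⟨b, rfl⟩ := hrange ha
      obtain ⟨c, hc, hcq⟩ := htrans (qone m) (qtop m)
      obtain ⟨d, hd, hdq⟩ := htrans (qtop m) (qone m)
      refine ⟨rootAut m c * spinalAut m ω b * rootAut m d,
        mul_mem (mul_mem (rootAut_mem_spinalGroup m ω hc) (spinalAut_mem_spinalGroup m GA ω b))
          (rootAut_mem_spinalGroup m ω hd), fun w => ?_⟩
      simp only [Equiv.Perm.mul_apply, rootAut_cons, hdq, spinalAut_qone_cons, hcq]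
    · exact ⟨_, spinalAut_mem_spinalGroup m GA ω b, spinalAut_qtop_cons m ω b⟩
  | one => exact ⟨1, one_mem _, fun w => rfl⟩
  | mul x y _ _ hx hy =>
    obtain ⟨g, hg, hgx⟩ := hx
    obtain ⟨k, hk, hky⟩ := hy
    exact ⟨g * k, mul_mem hg hk, fun w => by simp only [Equiv.Perm.mul_apply, hky, hgx]⟩
  | inv x _ hx =>
    obtain ⟨g, hg, hgx⟩ := hx
    refine ⟨g⁻¹, inv_mem hg, fun w => ?_⟩
    rw [Equiv.Perm.inv_eq_iff_eq, hgx, ← Equiv.Perm.mul_apply, mul_inv_cancel,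
      Equiv.Perm.one_apply]

/-- The spinal group acts transitively on every level of the tree. -/
theorem exists_mem_spinalGroup_apply_eq (m : ℕ) {GA : Subgroup (Equiv.Perm (Fin (m + 2)))}
    (htrans : ∀ i j : Fin (m + 2), ∃ a ∈ GA, a i = j) (u v : List (Fin (m + 2)))
    (huv : u.length = v.length) (ω : ℕ → GB →* Equiv.Perm (Fin (m + 2)))
    (hrange : ∀ n, GA ≤ (ω n).range) : ∃ g ∈ spinalGroup m GA ω, g u = v := by
  induction u generalizing v ω with
  | nil =>
    obtain rfl : v = [] := List.length_eq_zero_iff.mp huv.symm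
    exact ⟨1, one_mem _, rfl⟩
  | cons y u ih =>
    cases v with
    | nil => simp at huv
    | cons z v =>
      obtain ⟨h, hh, hhu⟩ := ih v (by simpa using huv) (fun k => ω (k + 1))
        fun n => hrange (n + 1)
      obtain ⟨g, hg, hgh⟩ := exists_lift_qtop m ω htrans (hrange 0) hh
      obtain ⟨c, hc, hcy⟩ := htrans y (qtop m)
      obtain ⟨d, hd, hdz⟩ := htrans (qtop m) z
      refine ⟨rootAut m d * g * rootAut m c,
        mul_mem (mul_mem (rootAut_mem_spinalGroup m ω hd) hg) (rootAut_mem_spinalGroup m ω hc), ?_⟩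
      simp only [Equiv.Perm.mul_apply, rootAut_cons, hcy, hgh, hhu, hdz]

/-- For every sequence `ω` in `Ω̂`, the spinal group `G_ω` is infinite. -/
theorem spinalGroup_infinite (m : ℕ) (GA : Subgroup (Equiv.Perm (Fin (m + 2))))
    {GB : Type*} [Group GB] [Finite GB] (ω : ℕ → GB →* Equiv.Perm (Fin (m + 2)))
    (hdata : SpinalData m GA ω) :
    Infinite (spinalGroup m GA ω) := by
  by_contra hfin
  rw [not_infinite_iff_finite] at hfin
  set N := Nat.card (spinalGroup m GA ω)
  let u : List (Fin (m + 2)) := List.replicate N (qtop m)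
  have hsurj (v : List.Vector (Fin (m + 2)) N) :
      ∃ g : spinalGroup m GA ω, (g : Equiv.Perm (List (Fin (m + 2)))) u = v.toList := by
    obtain ⟨g, hg, hgu⟩ := exists_mem_spinalGroup_apply_eq m hdata.transitive u v.toList
      (by simp [u]) ω fun n => (hdata.range_eq n).ge
    exact ⟨⟨g, hg⟩, hgu⟩
  choose f hf using hsurj
  have hinj : Function.Injective f := fun v w hvw =>
    List.Vector.toList_injective (by rw [← hf v, hvw, hf w])
  have hle := Nat.card_le_card_of_injective f hinj
  rw [Nat.card_eq_fintype_card, card_vector, Fintype.card_fin] at hle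
  exact hle.not_gt (Nat.lt_pow_self (by omega))
end Spinal
end
end

section
/- For every sequence ω in Ω̂ and every r ∈ ℕ, the subgroup D_r of G_ω generated by A together with the set {b_ω : b ∈ K_r}, where K_r = Ker(ω_r) and b_ω denotes the tree automorphism induced by b via ω, is finite. -/
noncomputable section

open Equiv

namespace Spinal

variable {GB : Type*} [Group GB]

theorem spinalFun_mul (m : ℕ) (ω : ℕ → GB →* Equiv.Perm (Fin (m + 2)))
    (b c : GB) (n : ℕ) (w : List (Fin (m + 2))) :
    spinalFun m ω (b * c) n w = spinalFun m ω b n (spinalFun m ω c n w) := by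
  induction w generalizing n with
  | nil => simp [spinalFun]
  | cons y w ih =>
    by_cases h1 : y = qtop m
    · simp [spinalFun, h1, ih]
    · by_cases h2 : y = qone m
      · match w with
        | [] => simp [spinalFun, h2]
        | z :: w' => simp [spinalFun, h2, qone_ne_qtop]
      · simp [spinalFun, h1, h2]

/-- The spinal action of `G_B` as a homomorphism. -/
def spinalHom (m : ℕ) (ω : ℕ → GB →* Equiv.Perm (Fin (m + 2))) :
    GB →* Equiv.Perm (List (Fin (m + 2))) :=
  MonoidHom.mk' (spinalAut m ω) fun b c => Equiv.ext fun w => spinalFun_mul m ω b c 0 w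

/-- The permutations of words that permute the first letter and act on the rest of the word,
depending on the first letter, by elements of `H`: the permutational wreath product of `H` with
the symmetric group of the alphabet. -/
def wreath {Y : Type*} (H : Subgroup (Equiv.Perm (List Y))) :
    Subgroup (Equiv.Perm (List Y)) where
  carrier := {g | g [] = [] ∧ ∃ (σ : Equiv.Perm Y) (h : Y → H),
    ∀ y w, g (y :: w) = σ y :: (h y : Equiv.Perm (List Y)) w}
  one_mem' := ⟨rfl, 1, 1, fun _ _ => rfl⟩
  mul_mem' := by
    rintro a b ⟨ha, σ, h, hσ⟩ ⟨hb, τ, k, hτ⟩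
    exact ⟨by simp [ha, hb], σ * τ, fun y => h (τ y) * k y, fun y w => by simp [hσ, hτ]⟩
  inv_mem' := by
    rintro a ⟨ha, σ, h, hσ⟩
    refine ⟨by rw [Equiv.Perm.inv_eq_iff_eq, ha], σ⁻¹, fun y => (h (σ⁻¹ y))⁻¹, fun y w => ?_⟩
    rw [Equiv.Perm.inv_eq_iff_eq, hσ]
    simp

theorem finite_wreath {Y : Type*} [Finite Y] (H : Subgroup (Equiv.Perm (List Y))) [Finite H] :
    Finite (wreath H) := by
  choose σ h hσ using fun g : wreath H => g.2.2
  refine Finite.of_injective (fun g => (σ g, h g)) fun g g' e => ?_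
  obtain ⟨e₁, e₂⟩ := Prod.mk.inj e
  refine Subtype.ext (Equiv.ext fun w => ?_)
  cases w with
  | nil => rw [g.2.1, g'.2.1]
  | cons y w => rw [hσ, hσ, e₁, e₂]

theorem rootAut_mem_wreath (m : ℕ) (H : Subgroup (Equiv.Perm (List (Fin (m + 2)))))
    (a : Equiv.Perm (Fin (m + 2))) : rootAut m a ∈ wreath H :=
  ⟨rfl, a, 1, fun _ _ => rfl⟩

theorem spinalAut_mem_wreath (m : ℕ) (ω : ℕ → GB →* Equiv.Perm (Fin (m + 2))) (b : GB)
    (H : Subgroup (Equiv.Perm (List (Fin (m + 2)))))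
    (htop : spinalAut m (fun k => ω (k + 1)) b ∈ H) (hone : rootAut m (ω 0 b) ∈ H) :
    spinalAut m ω b ∈ wreath H := by
  refine ⟨rfl, 1, fun y => if y = qtop m then ⟨_, htop⟩ else
    if y = qone m then ⟨_, hone⟩ else 1, fun y w => ?_⟩
  change spinalFun m ω b 0 (y :: w) = _
  by_cases h1 : y = qtop m
  · simp only [spinalFun, h1, if_true, spinalFun_succ]
    rfl
  · by_cases h2 : y = qone m
    · cases w <;> simp [spinalFun, h2, qone_ne_qtop, rootAut, rootFun]
    · simp [spinalFun, h1, h2]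

theorem rootAut_one (m : ℕ) : rootAut m 1 = 1 := by
  ext1 w
  cases w <;> rfl

/-- No condition on `ω` is needed for the finiteness of the group generated by all root
permutations together with the spinal automorphisms of the elements of `Ker (ω r)`. -/
theorem finite_closure_range_rootAut_union [Finite GB] (m r : ℕ)
    (ω : ℕ → GB →* Equiv.Perm (Fin (m + 2))) :
    Finite (Subgroup.closure (Set.range (rootAut m) ∪
      ((fun b : GB => spinalAut m ω b) '' ((ω r).ker : Set GB)))) := by
  induction r generalizing ω with
  | zero =>
    let H := (spinalHom m fun k => ω (k + 1)).range
    have : Finite H := (Set.finite_range (spinalHom m fun k => ω (k + 1))).to_subtype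
    have := finite_wreath H
    refine Finite.of_injective _ (Subgroup.inclusion_injective (K := wreath H)
      ((Subgroup.closure_le _).2 ?_))
    rintro _ (⟨a, rfl⟩ | ⟨b, hb, rfl⟩)
    · exact rootAut_mem_wreath m H a
    · refine spinalAut_mem_wreath m ω b H ⟨b, rfl⟩ ?_
      rw [show ω 0 b = 1 from hb, rootAut_one]
      exact H.one_mem
  | succ r ih =>
    let D := Subgroup.closure (Set.range (rootAut m) ∪
      ((fun b : GB => spinalAut m (fun k => ω (k + 1)) b) '' ((ω (r + 1)).ker : Set GB)))
    have : Finite D := ih fun k => ω (k + 1)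
    have := finite_wreath D
    refine Finite.of_injective _ (Subgroup.inclusion_injective (K := wreath D)
      ((Subgroup.closure_le _).2 ?_))
    rintro _ (⟨a, rfl⟩ | ⟨b, hb, rfl⟩)
    · exact rootAut_mem_wreath m _ a
    · exact spinalAut_mem_wreath m ω b _ (Subgroup.subset_closure (.inr ⟨b, hb, rfl⟩))
        (Subgroup.subset_closure (.inl ⟨_, rfl⟩))

/-- For every `ω ∈ Ω̂` and every `r`, the subgroup `D_r = ⟨A, K_r⟩` of `G_ω`, generated by
`A` together with the tree automorphisms induced by the elements of `K_r = Ker ω_r`,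
is finite. -/
theorem finite_D_r (m : ℕ) (GA : Subgroup (Equiv.Perm (Fin (m + 2))))
    {GB : Type*} [Group GB] [Finite GB] (ω : ℕ → GB →* Equiv.Perm (Fin (m + 2)))
    (hdata : SpinalData m GA ω) (r : ℕ) :
    Finite ↥(Subgroup.closure
      ((rootAut m '' (GA : Set (Equiv.Perm (Fin (m + 2))))) ∪
        ((fun b : GB => spinalAut m ω b) '' ((ω r).ker : Set GB)))) := by
  have := finite_closure_range_rootAut_union m r ω
  exact Finite.of_injective _ (Subgroup.inclusion_injective
    (Subgroup.closure_mono (Set.union_subset_union_left _ (Set.image_subset_range _ _))))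
end Spinal
end
end

section
/- If F is a word over S_ω = A ∪ B_ω that represents the identity element of G_ω, then the product, taken in order, of the images in the abelianization G_B^{ab} of the B-letters of F (i.e., of the elements b ∈ G_B corresponding to the letters of F lying in B_ω) is the identity of G_B^{ab}. -/
noncomputable section

open Equiv

namespace Spinal

variable {GB : Type*} [Group GB]

/-- The product, in order, of the images in `G_B^{ab}` of the `B`-letters of a word. -/
def abProd {m : ℕ} (F : List (Letter m GB)) : Abelianization GB :=
  ((bLetters F).map fun b => (Abelianization.of b : Abelianization GB)).prod

@[simp]
theorem bLetters_nil {m : ℕ} {GB : Type*} : bLetters ([] : List (Letter m GB)) = [] := rfl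

@[simp]
theorem bLetters_inl_cons {m : ℕ} {GB : Type*} (a : Equiv.Perm (Fin (m + 2)))
    (F : List (Letter m GB)) : bLetters (Sum.inl a :: F) = bLetters F := rfl

@[simp]
theorem bLetters_inr_cons {m : ℕ} {GB : Type*} (b : GB) (F : List (Letter m GB)) :
    bLetters (Sum.inr b :: F) = b :: bLetters F := rfl

theorem spinalAut_mul (m : ℕ) (ω : ℕ → GB →* Equiv.Perm (Fin (m + 2))) (b c : GB) :
    spinalAut m ω (b * c) = spinalAut m ω b * spinalAut m ω c :=
  Equiv.ext fun w => spinalFun_mul m ω b c 0 w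

theorem spinalAut_one (m : ℕ) (ω : ℕ → GB →* Equiv.Perm (Fin (m + 2))) :
    spinalAut m ω 1 = 1 := by
  simpa using spinalAut_mul m ω 1 1

theorem map_eq_one_of_spinalAut_eq_one (m : ℕ) (b : GB) (j : ℕ)
    (ω : ℕ → GB →* Equiv.Perm (Fin (m + 2))) (h : spinalAut m ω b = 1) : ω j b = 1 := by
  induction j generalizing ω with
  | zero =>
    ext1 z
    have hz : spinalFun m ω b 0 [qone m, z] = [qone m, z] := DFunLike.congr_fun h [qone m, z]
    simpa [spinalFun, qone_ne_qtop] using hz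
  | succ j ih =>
    refine ih (fun k => ω (k + 1)) (Equiv.ext fun w => ?_)
    have hw : spinalFun m ω b 0 (qtop m :: w) = qtop m :: w := DFunLike.congr_fun h (qtop m :: w)
    simp only [spinalFun, if_true, spinalFun_succ, List.cons.injEq, true_and] at hw
    exact hw

theorem eval_map_inr (m : ℕ) (ω : ℕ → GB →* Equiv.Perm (Fin (m + 2))) (l : List GB) :
    ((l.map Sum.inr).map (evalLetter m ω)).prod = spinalAut m ω l.prod := by
  induction l with
  | nil => simp [spinalAut_one]
  | cons b l ih =>
    rw [List.prod_cons, spinalAut_mul, ← ih]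
    rfl

theorem length_bLetters_le {m : ℕ} {GB : Type*} (F : List (Letter m GB)) :
    (bLetters F).length ≤ F.length :=
  List.length_filterMap_le _ _

theorem eq_map_inr_bLetters {m : ℕ} {GB : Type*} (F : List (Letter m GB))
    (h : F.length ≤ (bLetters F).length) : F = (bLetters F).map Sum.inr := by
  induction F with
  | nil => rfl
  | cons x F ih =>
    have := length_bLetters_le F
    rcases x with a | b
    · simp only [bLetters_inl_cons, List.length_cons] at h
      omega
    · simp only [bLetters_inr_cons, List.length_cons, Nat.add_le_add_iff_right] at h
      rw [bLetters_inr_cons, List.map_cons, ← ih h]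

/-- Each `B`-letter contributes at most one letter to a given projection. -/
theorem length_projWord_le (m : ℕ) (ω0 : GB →* Equiv.Perm (Fin (m + 2))) (i : Fin (m + 2))
    (F : List (Letter m GB)) (g : Equiv.Perm (Fin (m + 2))) :
    (projWord m ω0 i F g).length ≤ (bLetters F).length := by
  induction F generalizing g with
  | nil => simp [projWord]
  | cons x F ih =>
    rcases x with a | b
    · simpa [projWord] using ih (g * a)
    · have := ih g
      by_cases h1 : g (qtop m) = i
      · have h2 : g (qone m) ≠ i := fun h => qone_ne_qtop m (g.injective (h.trans h1.symm))
        simpa [projWord, h1, h2] using this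
      · by_cases h2 : g (qone m) = i
        · simpa [projWord, h1, h2] using this
        · simp only [projWord, h1, h2, if_false, List.nil_append, bLetters_inr_cons,
            List.length_cons]
          omega

/-- The `B`-letters of a word are distributed among its projections. -/
theorem prod_abProd_projWord (m : ℕ) (ω0 : GB →* Equiv.Perm (Fin (m + 2)))
    (F : List (Letter m GB)) (g : Equiv.Perm (Fin (m + 2))) :
    ∏ i, abProd (projWord m ω0 i F g) = abProd F := by
  induction F generalizing g with
  | nil => simp [projWord, abProd]
  | cons x F ih =>
    rcases x with a | b
    · exact ih (g * a)
    · have step (i : Fin (m + 2)) : abProd (projWord m ω0 i (Sum.inr b :: F) g) =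
          (if g (qtop m) = i then Abelianization.of b else 1) * abProd (projWord m ω0 i F g) := by
        by_cases h1 : g (qtop m) = i <;> by_cases h2 : g (qone m) = i <;>
          simp [projWord, h1, h2, abProd]
      simp only [step, Finset.prod_mul_distrib, ih, Finset.prod_ite_eq, Finset.mem_univ, if_true]
      simp [abProd]

/-- The action of a word below the first level is given by its projections. -/
theorem eval_cons (m : ℕ) (ω : ℕ → GB →* Equiv.Perm (Fin (m + 2))) (F : List (Letter m GB))
    (y : Fin (m + 2)) (w : List (Fin (m + 2))) :
    ∃ z, ∀ g : Equiv.Perm (Fin (m + 2)), (F.map (evalLetter m ω)).prod (y :: w) =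
      z :: ((projWord m (ω 0) (g z) F g).map (evalLetter m fun k => ω (k + 1))).prod w := by
  induction F with
  | nil => exact ⟨y, fun g => by simp [projWord]⟩
  | cons x F ih =>
    obtain ⟨z, hz⟩ := ih
    rcases x with a | b
    · refine ⟨a z, fun g => ?_⟩
      rw [List.map_cons, List.prod_cons, Equiv.Perm.mul_apply, hz (g * a)]
      rfl
    · refine ⟨z, fun g => ?_⟩
      rw [List.map_cons, List.prod_cons, Equiv.Perm.mul_apply, hz g]
      generalize hu : projWord m (ω 0) (g z) F g = u
      change spinalFun m ω b 0 (z :: _) = _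
      by_cases h1 : z = qtop m
      · subst h1
        simp only [spinalFun, spinalFun_succ, projWord, hu, if_true, g.injective.eq_iff,
          qone_ne_qtop, if_false]
        rfl
      · by_cases h2 : z = qone m
        · subst h2
          simp only [spinalFun, projWord, hu, if_true, g.injective.eq_iff,
            h1, Ne.symm h1, if_false]
          rfl
        · simp [spinalFun, projWord, hu, h1, h2, Ne.symm h1, Ne.symm h2]

theorem abProd_eq_one_of_eval_eq_one (m : ℕ) (ω : ℕ → GB →* Equiv.Perm (Fin (m + 2)))
    (hsep : ∀ i : ℕ, ∀ b : GB, (∀ j, i ≤ j → ω j b = 1) → b = 1) (F : List (Letter m GB))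
    (hF : (F.map (evalLetter m ω)).prod = 1) : abProd F = 1 := by
  induction hn : (bLetters F).length using Nat.strong_induction_on generalizing ω F with
  | _ n ih =>
    subst hn
    have hsep' (i : ℕ) (b : GB) (h : ∀ j, i ≤ j → ω (j + 1) b = 1) : b = 1 :=
      hsep (i + 1) b fun j hj => by
        obtain ⟨k, rfl⟩ := Nat.exists_eq_add_of_le' (Nat.le_trans (Nat.le_add_left 1 i) hj)
        exact h k (by omega)
    rw [← prod_abProd_projWord m (ω 0) F 1]
    refine Finset.prod_eq_one fun i _ => ?_
    have hproj : ((projWord m (ω 0) i F 1).map (evalLetter m fun k => ω (k + 1))).prod = 1 := by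
      ext1 w
      obtain ⟨z, hz⟩ := eval_cons m ω F i w
      have h := hz 1
      rw [hF, Equiv.Perm.one_apply, List.cons.injEq] at h
      obtain ⟨rfl, h⟩ := h
      exact h.symm
    rcases lt_or_ge (bLetters (projWord m (ω 0) i F 1)).length (bLetters F).length with hlt | hge
    · exact ih _ hlt _ hsep' _ hproj rfl
    · rw [eq_map_inr_bLetters _ ((length_projWord_le m (ω 0) i F 1).trans hge), eval_map_inr]
        at hproj
      rw [abProd, ← map_list_prod, hsep' 0 _ fun j _ => map_eq_one_of_spinalAut_eq_one m _ j _ hproj,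
        map_one]

/-- If a word `F` over `S_ω = A ∪ B_ω` represents the identity of `G_ω`, then the product,
in order, of the images in `G_B^{ab}` of the `B`-letters of `F` is the identity. -/
theorem bLetters_abelianization_prod_eq_one (m : ℕ)
    (GA : Subgroup (Equiv.Perm (Fin (m + 2))))
    {GB : Type*} [Group GB] [Finite GB] (ω : ℕ → GB →* Equiv.Perm (Fin (m + 2)))
    (hdata : SpinalData m GA ω) (F : List (Letter m GB))
    (hA : ∀ a : Equiv.Perm (Fin (m + 2)), Sum.inl a ∈ F → a ∈ GA)
    (hF : (F.map (evalLetter m ω)).prod = 1) :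
    ((bLetters F).map fun b => (Abelianization.of b : Abelianization GB)).prod = 1 := by
  exact abProd_eq_one_of_eval_eq_one m ω hdata.kernels_sep F hF
end Spinal
end
end

section
/- Let ω ∈ Ω̂ be a sequence whose initial segment ω₁…ω_r is complete. Then for every reduced word F over S_ω representing an element of H_ω^{(r)}, the total length of level r of the depth-r decomposition of F satisfies |L_r(F)| ≤ (3/4)·|F| + q^r. -/
noncomputable section

open Equiv

namespace Spinal

variable {GB : Type*} [Group GB]

open scoped Classical in
/-- Twice the potential of a letter with respect to the next `r` homomorphisms: a nontrivial
`A`-letter has potential `1`, and a `B`-letter has potential `1/2` if it is killed by one of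
the first `r` homomorphisms and `1` otherwise. -/
def potential {m : ℕ} (ω : ℕ → GB →* Equiv.Perm (Fin (m + 2))) (r : ℕ) : Letter m GB → ℕ
  | Sum.inl a => if a = 1 then 0 else 2
  | Sum.inr b => if ∃ j < r, ω j b = 1 then 1 else 2

theorem one_le_potential_inr {m : ℕ} (ω : ℕ → GB →* Equiv.Perm (Fin (m + 2))) (r : ℕ) (b : GB) :
    1 ≤ potential ω r (Sum.inr b) := by
  simp only [potential]; split_ifs <;> omega

theorem potential_le_two {m : ℕ} (ω : ℕ → GB →* Equiv.Perm (Fin (m + 2))) (r : ℕ)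
    (x : Letter m GB) : potential ω r x ≤ 2 := by
  cases x <;> simp only [potential] <;> split_ifs <;> omega

theorem potential_inl_mul_le {m : ℕ} (ω : ℕ → GB →* Equiv.Perm (Fin (m + 2))) (r : ℕ)
    (a a' : Equiv.Perm (Fin (m + 2))) :
    potential ω r (Sum.inl (a * a')) ≤
      potential ω r (Sum.inl a) + potential ω r (Sum.inl a') := by
  by_cases h : a = 1
  · simp [h]
  · have := potential_le_two ω r (Sum.inl (a * a'))
    have h2 : potential ω r (Sum.inl a) = 2 := by simp [potential, h]
    omega

theorem potential_inr_mul_le {m : ℕ} (ω : ℕ → GB →* Equiv.Perm (Fin (m + 2))) (r : ℕ)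
    (b b' : GB) :
    potential ω r (Sum.inr (b * b')) ≤
      potential ω r (Sum.inr b) + potential ω r (Sum.inr b') := by
  have := potential_le_two ω r (Sum.inr (b * b'))
  have := one_le_potential_inr ω r b
  have := one_le_potential_inr ω r b'
  omega

theorem potential_reduceStep_le {m : ℕ} (ω : ℕ → GB →* Equiv.Perm (Fin (m + 2))) (r : ℕ)
    (x : Letter m GB) (F : List (Letter m GB)) :
    ((reduceStep x F).map (potential ω r)).sum ≤
      potential ω r x + (F.map (potential ω r)).sum := by
  rcases x with a | b <;> rcases F with _ | ⟨a' | b', t⟩ <;> simp only [reduceStep] <;>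
    split_ifs <;> simp only [List.map_cons, List.map_nil, List.sum_cons, List.sum_nil]
  all_goals try omega
  · have := potential_inl_mul_le ω r a a'
    omega
  · have := potential_inr_mul_le ω r b b'
    omega

theorem potential_reduceWord_le {m : ℕ} (ω : ℕ → GB →* Equiv.Perm (Fin (m + 2))) (r : ℕ)
    (F : List (Letter m GB)) :
    ((reduceWord F).map (potential ω r)).sum ≤ (F.map (potential ω r)).sum := by
  induction F with
  | nil => simp [reduceWord]
  | cons x F ih =>
    have := potential_reduceStep_le ω r x (reduceWord F)
    simp only [List.map_cons, List.sum_cons]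
    exact this.trans (by omega)

theorem isReduced_iff {m : ℕ} {F : List (Letter m GB)} :
    IsReduced F ↔ List.IsChain (fun x y => x.isLeft ≠ y.isLeft) F ∧
      Sum.inl 1 ∉ F ∧ Sum.inr 1 ∉ F :=
  Iff.rfl

theorem IsReduced.tail {m : ℕ} {x : Letter m GB} {F : List (Letter m GB)}
    (h : IsReduced (x :: F)) : IsReduced F :=
  ⟨List.IsChain.tail h.1, fun h1 => h.2.1 (List.mem_cons_of_mem _ h1),
    fun h1 => h.2.2 (List.mem_cons_of_mem _ h1)⟩

theorem IsReduced.reduceStep {m : ℕ} (x : Letter m GB) {F : List (Letter m GB)}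
    (h : IsReduced F) : IsReduced (reduceStep x F) := by
  have ht := fun (y : Letter m GB) t (e : F = y :: t) => IsReduced.tail (e ▸ h)
  rcases x with a | b <;> rcases F with _ | ⟨a' | b', t⟩ <;> simp only [Spinal.reduceStep] <;>
    split_ifs with h1
  all_goals first
    | exact h
    | exact ht _ _ rfl
    | (simp only [isReduced_iff, List.isChain_cons, List.mem_cons, not_or] at h ⊢
       grind)

theorem isReduced_reduceWord {m : ℕ} (F : List (Letter m GB)) : IsReduced (reduceWord F) := by
  induction F with
  | nil => simp [reduceWord, isReduced_iff]
  | cons x F ih => exact ih.reduceStep x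

theorem IsReduced.count_not_le {m : ℕ} {F : List (Letter m GB)} (h : IsReduced F) (c : Bool) :
    (F.map Sum.isLeft).count (!c) ≤ (F.map Sum.isLeft).count c + 1 :=
  List.IsChain.count_not_le_count_add_one ((List.isChain_map Sum.isLeft).2 h.1) c

theorem sum_potential_projWord {m : ℕ} (ω : ℕ → GB →* Equiv.Perm (Fin (m + 2))) (r : ℕ)
    (ω0 : GB →* Equiv.Perm (Fin (m + 2))) (F : List (Letter m GB))
    (g : Equiv.Perm (Fin (m + 2))) :
    ∑ i, ((projWord m ω0 i F g).map (potential ω r)).sum =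
      (F.map (Sum.elim (fun _ => 0) fun b =>
        potential ω r (Sum.inr b) + potential ω r (Sum.inl (ω0 b)))).sum := by
  induction F generalizing g with
  | nil => simp [projWord]
  | cons x F ih =>
    rcases x with a | b
    · simp [projWord, ih]
    · simp [projWord, Finset.sum_add_distrib, ih, apply_ite (List.map _), apply_ite List.sum,
        add_assoc]

theorem potential_shift_le {m : ℕ} (ω : ℕ → GB →* Equiv.Perm (Fin (m + 2))) (r : ℕ) (b : GB) :
    potential (fun n => ω (n + 1)) r (Sum.inr b) + potential (fun n => ω (n + 1)) r
      (Sum.inl (ω 0 b) : Letter m GB) ≤ potential ω (r + 1) (Sum.inr b) + 2 := by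
  by_cases h0 : ω 0 b = 1
  · have := potential_le_two (fun n => ω (n + 1)) r (Sum.inr b)
    simp only [potential, h0, if_true] at this ⊢
    omega
  · have : (∃ j < r + 1, ω j b = 1) ↔ ∃ j < r, ω (j + 1) b = 1 := by
      constructor
      · rintro ⟨_ | j, hj, h⟩
        · exact absurd h h0
        · exact ⟨j, by omega, h⟩
      · rintro ⟨j, hj, h⟩
        exact ⟨j + 1, by omega, h⟩
    simp only [potential, h0, this, if_false, le_refl]

/-- Passing to the projections raises the potential by at most `1` for each `B`-letter in excess
of the `A`-letters. -/
theorem sum_projection_le {m : ℕ} (ω : ℕ → GB →* Equiv.Perm (Fin (m + 2))) (r : ℕ)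
    {F : List (Letter m GB)} (hF : Sum.inl 1 ∉ F) :
    (F.map (Sum.elim (fun _ => 0) fun b => potential (fun n => ω (n + 1)) r (Sum.inr b) +
        potential (fun n => ω (n + 1)) r (Sum.inl (ω 0 b) : Letter m GB))).sum +
        2 * (F.map Sum.isLeft).count true ≤
      (F.map (potential ω (r + 1))).sum + 2 * (F.map Sum.isLeft).count false := by
  induction F with
  | nil => simp
  | cons x F ih =>
    simp only [List.mem_cons, not_or] at hF
    have := ih hF.2
    rcases x with a | b
    · have ha : potential ω (r + 1) (Sum.inl a) = 2 := by
        simp [potential, show a ≠ 1 from fun h => hF.1 (h ▸ rfl)]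
      simp [ha]
      omega
    · have := potential_shift_le ω r b
      simp
      omega

theorem levelLength_succ {m : ℕ} (ω : ℕ → GB →* Equiv.Perm (Fin (m + 2))) (r : ℕ)
    (F : List (Letter m GB)) :
    levelLength m ω (r + 1) F =
      ∑ i, levelLength m (fun n => ω (n + 1)) r (reduceWord (projWord m (ω 0) i F 1)) := by
  simp only [levelLength, levelWords, Fin.sum_univ_def, List.map_flatMap]
  rw [List.flatMap, List.sum_flatten, List.map_map]
  rfl

theorem length_le_potential {m : ℕ} (ω : ℕ → GB →* Equiv.Perm (Fin (m + 2)))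
    {F : List (Letter m GB)} (hF : Sum.inl 1 ∉ F) :
    2 * F.length ≤ (F.map (potential ω 0)).sum := by
  induction F with
  | nil => simp
  | cons x F ih =>
    simp only [List.mem_cons, not_or] at hF
    have := ih hF.2
    have hx : potential ω 0 x = 2 := by
      rcases x with a | b
      · simp [potential, show a ≠ 1 from fun h => hF.1 (h ▸ rfl)]
      · simp [potential]
    simp [hx]
    omega

theorem IsReduced.levelLength_le {m : ℕ} (ω : ℕ → GB →* Equiv.Perm (Fin (m + 2))) (r : ℕ)
    {F : List (Letter m GB)} (hF : IsReduced F) :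
    2 * levelLength m ω r F + 2 ≤ (F.map (potential ω r)).sum + 2 * (m + 2) ^ r := by
  induction r generalizing ω F with
  | zero =>
    have := length_le_potential ω hF.2.1
    simp [levelLength, levelWords]
    omega
  | succ r ih =>
    have hsum : ∑ i : Fin (m + 2), (2 * levelLength m (fun n => ω (n + 1)) r
        (reduceWord (projWord m (ω 0) i F 1)) + 2) ≤
        ∑ i : Fin (m + 2), (((projWord m (ω 0) i F 1).map
          (potential (fun n => ω (n + 1)) r)).sum + 2 * (m + 2) ^ r) :=
      Finset.sum_le_sum fun i _ => (ih (fun n => ω (n + 1)) (isReduced_reduceWord _)).trans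
        (by gcongr; exact potential_reduceWord_le _ _ _)
    simp only [Finset.sum_add_distrib, ← Finset.mul_sum, ← levelLength_succ,
      sum_potential_projWord, Finset.sum_const, Finset.card_univ, Fintype.card_fin,
      smul_eq_mul] at hsum
    have h1 := sum_projection_le ω r hF.2.1
    have h2 := hF.count_not_le true
    simp only [Bool.not_true] at h2
    rw [pow_succ']
    omega

theorem potential_of_complete {m : ℕ} (ω : ℕ → GB →* Equiv.Perm (Fin (m + 2))) (r : ℕ)
    (hcomplete : ∀ b : GB, ∃ j < r, ω j b = 1) (F : List (Letter m GB)) :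
    (F.map (potential ω r)).sum + (F.map Sum.isLeft).count false ≤ 2 * F.length := by
  induction F with
  | nil => simp
  | cons x F ih =>
    rcases x with a | b
    · have := potential_le_two ω r (Sum.inl a)
      simp
      omega
    · simp [potential, hcomplete b]
      omega

/-- 3/4-Shortening: if the initial segment `ω₁…ω_r` of `ω ∈ Ω̂` is complete, then for every
reduced word `F` over `S_ω` representing an element of `H_ω^{(r)}` (the stabilizer of
level `r` in `G_ω`), the total length of level `r` of the depth-`r` decomposition of `F`
satisfies `|L_r(F)| ≤ (3/4)·|F| + q^r`. -/
theorem three_quarters_shortening (m : ℕ) (GA : Subgroup (Equiv.Perm (Fin (m + 2))))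
    {GB : Type*} [Group GB] [Finite GB] (ω : ℕ → GB →* Equiv.Perm (Fin (m + 2)))
    (hdata : SpinalData m GA ω) (r : ℕ)
    (hcomplete : ∀ b : GB, ∃ j < r, ω j b = 1)
    (F : List (Letter m GB)) (hred : IsReduced F)
    (hA : ∀ a : Equiv.Perm (Fin (m + 2)), Sum.inl a ∈ F → a ∈ GA)
    (hstab : ∀ w : List (Fin (m + 2)), w.length = r → (F.map (evalLetter m ω)).prod w = w) :
    (levelLength m ω r F : ℝ) ≤ 3 / 4 * F.length + (m + 2 : ℝ) ^ r := by
  have h1 := hred.levelLength_le ω r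
  have h2 := potential_of_complete ω r hcomplete F
  have h3 := hred.count_not_le false
  have h4 : (F.map Sum.isLeft).count true + (F.map Sum.isLeft).count false = F.length := by
    rw [List.count_true_add_count_false, List.length_map]
  have h5 : 4 * levelLength m ω r F ≤ 3 * F.length + 4 * (m + 2) ^ r := by
    simp only [Bool.not_false] at h3
    omega
  have h6 : (4 * levelLength m ω r F : ℝ) ≤ 3 * F.length + 4 * (m + 2) ^ r := by
    exact_mod_cast h5
  linarith
end Spinal
end
end
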